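/- arXiv:1904.05001 — 3 statements merged into one kernel-verified Lean document; each statement's English description precedes it below -/
import Mathlib

section
/- The product of the stabilizer projectors over all vertices equals the rank-one orthogonal projection onto the graph state: for every vector ψ in the N-qubit Hilbert space, (∏_{i ∈ V} (S_i + I)/2) ψ = ⟨g, ψ⟩ · g (the factors commute, so the product is independent of the order). -/
open Matrix Finset
open scoped Classical ComplexOrder

noncomputable section

variable {V : Type} [Fintype V] [DecidableEq V]

/-- The indicator function δ_i : V → ZMod 2 of a vertex `i`. -/
def delta (i : V) : V → ZMod 2 := fun v => if v = i then 1 else 0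

/-- The stabilizer `S_i = X_i ⊗_{j ∈ N(i)} Z_j` of the graph `G` at vertex `i`,
as a matrix acting on the N-qubit Hilbert space `(V → ZMod 2) → ℂ`:
`(S_i ψ)(x) = (-1)^{∑_{j ∈ N(i)} x(j)} ψ(x + δ_i)`. -/
def stab (G : SimpleGraph V) (i : V) : Matrix (V → ZMod 2) (V → ZMod 2) ℂ :=
  Matrix.of fun x y =>
    if y = x + delta i then ((-1 : ℂ) ^ (∑ j ∈ univ.filter (fun j => G.Adj i j), (x j).val))
    else 0

/-- The number of edges `{i,j}` of `G` with `x i = x j = 1`. -/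
def edgeCount (G : SimpleGraph V) (x : V → ZMod 2) : ℕ :=
  (G.edgeFinset.filter (fun e => ∀ v ∈ e, x v = 1)).card

/-- The graph state of `G`: `g(x) = 2^{-N/2} (-1)^{e(x)}`. -/
def graphState (G : SimpleGraph V) : (V → ZMod 2) → ℂ :=
  fun x => ((-1 : ℂ) ^ edgeCount G x) / ((Real.sqrt 2 ^ Fintype.card V : ℝ) : ℂ)

/-- The stabilizer projector `∏_{i ∈ W} (S_i + I)/2` (the factors pairwise commute, so
the order of multiplication is irrelevant; we use the canonical enumeration of `W`). -/
def stabProj (G : SimpleGraph V) (W : Finset V) : Matrix (V → ZMod 2) (V → ZMod 2) ℂ :=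
  (W.toList.map (fun i => (2:ℂ)⁻¹ • (stab G i + 1))).prod

/-- The off-diagonal adjacency block `Γ_{A,Ā}` over `ZMod 2`. -/
def gammaMat (G : SimpleGraph V) (A : Finset V) :
    Matrix {v // v ∈ A} {v // v ∉ A} (ZMod 2) :=
  Matrix.of fun i j => if G.Adj i.1 j.1 then 1 else 0

/-- `r(A)`: the rank of `Γ_{A,Ā}` over `ZMod 2`. -/
def gRank (G : SimpleGraph V) (A : Finset V) : ℕ := (gammaMat G A).rank

/-- Restriction of a computational-basis label to a subset `A`. -/
def restrictTo (A : Finset V) (x : V → ZMod 2) : {v // v ∈ A} → ZMod 2 := fun v => x v.1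

/-- Restriction of a computational-basis label to the complement of `A`. -/
def restrictOut (A : Finset V) (x : V → ZMod 2) : {v // v ∉ A} → ZMod 2 := fun v => x v.1

/-- `ψ` is a product vector across the bipartition `{A, V \ A}`. -/
def IsProdVec (A : Finset V) (ψ : (V → ZMod 2) → ℂ) : Prop :=
  ∃ (φ : ({v // v ∈ A} → ZMod 2) → ℂ) (χ : ({v // v ∉ A} → ZMod 2) → ℂ),
    ∀ x, ψ x = φ (restrictTo A x) * χ (restrictOut A x)

/-- `P : Fin m → Finset V` is a partition of `V` into `m` nonempty disjoint subsets. -/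
def IsPartition {m : ℕ} (P : Fin m → Finset V) : Prop :=
  (∀ t, (P t).Nonempty) ∧ (∀ t t', t ≠ t' → Disjoint (P t) (P t')) ∧
    univ.biUnion P = univ

/-- `ψ` is a unit vector: `⟨ψ, ψ⟩ = 1`. -/
def IsUnit' (ψ : (V → ZMod 2) → ℂ) : Prop := star ψ ⬝ᵥ ψ = 1

/-- A pure state fully separable with respect to the partition `P`:
`ψ(x) = ∏_t φ_t(x|_{A_t})`. -/
def FullSepPure {m : ℕ} (P : Fin m → Finset V) (ψ : (V → ZMod 2) → ℂ) : Prop :=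
  ∃ φ : (t : Fin m) → ({v // v ∈ P t} → ZMod 2) → ℂ,
    ∀ x, ψ x = ∏ t, φ t (restrictTo (P t) x)

/-- A `P`-fully separable density matrix. -/
def FullSep {m : ℕ} (P : Fin m → Finset V) (ρ : Matrix (V → ZMod 2) (V → ZMod 2) ℂ) : Prop :=
  ∃ (M : ℕ) (p : Fin M → ℝ) (ψ : Fin M → ((V → ZMod 2) → ℂ)),
    (∀ i, 0 ≤ p i) ∧ (∑ i, p i) = 1 ∧ (∀ i, IsUnit' (ψ i)) ∧
    (∀ i, FullSepPure P (ψ i)) ∧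
    ρ = ∑ i, (p i : ℂ) • vecMulVec (ψ i) (star (ψ i))

/-- A `P`-bi-separable density matrix: a convex mixture of unit vectors each of which is a
product vector across `{A, V \ A}` for some nonempty proper union of parts `A` of `P`. -/
def BiSep {m : ℕ} (P : Fin m → Finset V) (ρ : Matrix (V → ZMod 2) (V → ZMod 2) ℂ) : Prop :=
  ∃ (M : ℕ) (p : Fin M → ℝ) (ψ : Fin M → ((V → ZMod 2) → ℂ)),
    (∀ i, 0 ≤ p i) ∧ (∑ i, p i) = 1 ∧ (∀ i, IsUnit' (ψ i)) ∧
    (∀ i, ∃ S : Finset (Fin m), S.Nonempty ∧ S ≠ univ ∧ IsProdVec (S.biUnion P) (ψ i)) ∧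
    ρ = ∑ i, (p i : ℂ) • vecMulVec (ψ i) (star (ψ i))

/-- An `m`-separable density matrix: a convex mixture of unit vectors each of which is
fully separable with respect to some partition of `V` into `m` nonempty parts. -/
def MSep (m : ℕ) (ρ : Matrix (V → ZMod 2) (V → ZMod 2) ℂ) : Prop :=
  ∃ (M : ℕ) (p : Fin M → ℝ) (ψ : Fin M → ((V → ZMod 2) → ℂ)),
    (∀ i, 0 ≤ p i) ∧ (∑ i, p i) = 1 ∧ (∀ i, IsUnit' (ψ i)) ∧
    (∀ i, ∃ P : Fin m → Finset V, IsPartition P ∧ FullSepPure P (ψ i)) ∧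
    ρ = ∑ i, (p i : ℂ) • vecMulVec (ψ i) (star (ψ i))

/-- A proper `k`-coloring of `G` with color classes `C 0, …, C (k-1)`:
the classes are disjoint, cover `V`, and each is an independent set. -/
def IsColoring (G : SimpleGraph V) {k : ℕ} (C : Fin k → Finset V) : Prop :=
  (∀ l l', l ≠ l' → Disjoint (C l) (C l')) ∧ univ.biUnion C = univ ∧
    ∀ l, ∀ i ∈ C l, ∀ j ∈ C l, ¬ G.Adj i j

/-- A density matrix: Hermitian positive semidefinite with trace 1. -/
def IsDensity (ρ : Matrix (V → ZMod 2) (V → ZMod 2) ℂ) : Prop :=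
  ρ.PosSemidef ∧ ρ.trace = 1

/-- Glue `a : A → ZMod 2` and `b : Ā → ZMod 2` into a function on `V`. -/
def glue (A : Finset V) (a : {v // v ∈ A} → ZMod 2) (b : {v // v ∉ A} → ZMod 2) :
    V → ZMod 2 := fun v => if h : v ∈ A then a ⟨v, h⟩ else b ⟨v, h⟩

/-- The reduced density matrix `ρ_A` of a pure state `ψ`. -/
def rdm (A : Finset V) (ψ : (V → ZMod 2) → ℂ) :
    Matrix ({v // v ∈ A} → ZMod 2) ({v // v ∈ A} → ZMod 2) ℂ :=
  Matrix.of fun a a' => ∑ b : {v // v ∉ A} → ZMod 2,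
    ψ (glue A a b) * (starRingEnd ℂ) (ψ (glue A a' b))


/-- The star graph on `Fin N` (center `0`, i.e. vertex labelled 1). -/
def starGraph (N : ℕ) : SimpleGraph (Fin N) :=
  SimpleGraph.fromRel (fun i _ => (i : ℕ) = 0)

/-- The path graph on `Fin N` (vertex `v` represents the label `v+1`). -/
def pathGraph (N : ℕ) : SimpleGraph (Fin N) :=
  SimpleGraph.fromRel (fun a b => (a : ℕ) + 1 = (b : ℕ))

/-- The `n × n` grid graph. -/
def gridGraph (n : ℕ) : SimpleGraph (Fin n × Fin n) :=
  SimpleGraph.fromRel (fun a b => Nat.dist (a.1 : ℕ) (b.1 : ℕ) + Nat.dist (a.2 : ℕ) (b.2 : ℕ) = 1)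

/-- The number of edges of `G` crossing the bipartition `{A, V \ A}` (each such edge is
counted once, as the ordered pair whose first component lies in `A`). -/
def crossCount {W : Type} [Fintype W] [DecidableEq W] (G : SimpleGraph W) (A : Finset W) : ℕ :=
  ((univ ×ˢ univ).filter fun p : W × W => G.Adj p.1 p.2 ∧ p.1 ∈ A ∧ p.2 ∉ A).card

/-- The contribution `-1` or `1` of an edge `e` to the sign of the graph state at `x`. -/
def edgeSign (x : V → ZMod 2) (e : Sym2 V) : ℂ :=
  if ∀ v ∈ e, x v = 1 then -1 else 1

/-- The sign `(-1)^{e(x)}` of the graph state at `x`. -/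
def graphSign (G : SimpleGraph V) (x : V → ZMod 2) : ℂ := (-1) ^ edgeCount G x

lemma graphSign_eq_prod (G : SimpleGraph V) (x : V → ZMod 2) :
    graphSign G x = ∏ e ∈ G.edgeFinset, edgeSign x e := by
  simp only [graphSign, edgeCount, edgeSign, Finset.prod_ite, Finset.prod_const, one_pow, mul_one]

lemma graphSign_mul_self (G : SimpleGraph V) (x : V → ZMod 2) :
    graphSign G x * graphSign G x = 1 := by
  rw [graphSign, ← mul_pow]
  simp

lemma star_graphSign (G : SimpleGraph V) (x : V → ZMod 2) :
    star (graphSign G x) = graphSign G x := by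
  simp [graphSign]

lemma edgeSign_mul_self (x : V → ZMod 2) (e : Sym2 V) : edgeSign x e * edgeSign x e = 1 := by
  unfold edgeSign
  split_ifs <;> norm_num

lemma edgeSign_add_delta_of_notMem (x : V → ZMod 2) {i : V} {e : Sym2 V} (h : i ∉ e) :
    edgeSign (x + delta i) e = edgeSign x e := by
  have key : ∀ v ∈ e, (x + delta i) v = x v := fun v hv => by
    have : v ≠ i := fun hvi => h (hvi ▸ hv)
    simp [delta, this]
  unfold edgeSign
  exact if_congr (forall₂_congr fun v hv => by rw [key v hv]) rfl rfl

lemma edgeSign_mul_edgeSign_add_delta (x : V → ZMod 2) {i j : V} (h : j ≠ i) :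
    edgeSign x s(i, j) * edgeSign (x + delta i) s(i, j) = (-1) ^ (x j).val := by
  have two : ∀ a : ZMod 2, a = 0 ∨ a = 1 := by decide
  rcases two (x i) with hi | hi <;> rcases two (x j) with hj | hj <;>
    simp [edgeSign, delta, h, hi, hj, ZMod.val_one]

lemma graphSign_mul_graphSign_add_delta (G : SimpleGraph V) (x : V → ZMod 2) (i : V) :
    graphSign G x * graphSign G (x + delta i) =
      (-1) ^ (∑ j ∈ univ.filter (fun j => G.Adj i j), (x j).val) := by
  rw [graphSign_eq_prod, graphSign_eq_prod, ← Finset.prod_mul_distrib, ← Finset.prod_pow_eq_pow_sum,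
    ← Finset.prod_filter_of_ne (p := fun e => i ∈ e)]
  · symm
    refine Finset.prod_nbij (fun j => s(i, j)) ?_ ?_ ?_ ?_
    · intro j hj
      simpa using hj
    · intro j _ k _ hjk
      exact Sym2.congr_right.mp hjk
    · intro e he
      simp only [Finset.coe_filter, Set.mem_ofPred_eq, SimpleGraph.mem_edgeFinset] at he
      obtain ⟨j, rfl⟩ := he.2
      exact ⟨j, by simpa using he.1, rfl⟩
    · intro j hj
      have hij : G.Adj i j := by simpa using hj
      exact (edgeSign_mul_edgeSign_add_delta x hij.ne').symm
  · intro e _ hne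
    by_contra hi
    exact hne (by rw [edgeSign_add_delta_of_notMem x hi, edgeSign_mul_self])

lemma stab_mulVec_apply (G : SimpleGraph V) (i : V) (ψ : (V → ZMod 2) → ℂ) (x : V → ZMod 2) :
    (stab G i *ᵥ ψ) x = graphSign G x * graphSign G (x + delta i) * ψ (x + delta i) := by
  rw [graphSign_mul_graphSign_add_delta]
  simp [stab, Matrix.mulVec, dotProduct]

/-- The product of the stabilizer projectors along a duplicate-free list averages the sign-twisted
vector over all shifts by subsets of the list. -/
lemma list_prod_stab_mulVec_apply (G : SimpleGraph V) (ψ : (V → ZMod 2) → ℂ) {l : List V}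
    (hl : l.Nodup) (x : V → ZMod 2) :
    ((l.map (fun i => (2 : ℂ)⁻¹ • (stab G i + 1))).prod *ᵥ ψ) x =
      (2 : ℂ)⁻¹ ^ l.length * (graphSign G x * ∑ T ∈ l.toFinset.powerset,
        graphSign G (x + ∑ i ∈ T, delta i) * ψ (x + ∑ i ∈ T, delta i)) := by
  induction l generalizing x with
  | nil =>
    simp [← mul_assoc, graphSign_mul_self]
  | cons i l ih =>
    obtain ⟨hi, hl⟩ := List.nodup_cons.mp hl
    have hi' : i ∉ l.toFinset := by simpa using hi
    have shift : ∑ T ∈ l.toFinset.powerset, graphSign G (x + ∑ j ∈ insert i T, delta j) *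
          ψ (x + ∑ j ∈ insert i T, delta j) =
        ∑ T ∈ l.toFinset.powerset, graphSign G (x + delta i + ∑ j ∈ T, delta j) *
          ψ (x + delta i + ∑ j ∈ T, delta j) :=
      Finset.sum_congr rfl fun T hT => by
        rw [Finset.sum_insert fun h => hi' (Finset.mem_powerset.mp hT h), add_assoc]
    rw [List.map_cons, List.prod_cons, ← Matrix.mulVec_mulVec, Matrix.smul_mulVec,
      Matrix.add_mulVec, Matrix.one_mulVec, Pi.smul_apply, Pi.add_apply, stab_mulVec_apply,
      ih hl, ih hl, List.toFinset_cons, Finset.sum_powerset_insert hi',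
      shift, List.length_cons, smul_eq_mul, pow_succ]
    linear_combination (2 : ℂ)⁻¹ * graphSign G x * (2 : ℂ)⁻¹ ^ l.length *
      (∑ T ∈ l.toFinset.powerset, graphSign G (x + delta i + ∑ j ∈ T, delta j) *
        ψ (x + delta i + ∑ j ∈ T, delta j)) * graphSign_mul_self G (x + delta i)

lemma sum_delta_apply {W : Type} [DecidableEq W] (T : Finset W) (v : W) :
    (∑ i ∈ T, delta i) v = if v ∈ T then 1 else 0 := by
  simp [delta, Finset.sum_apply]

lemma sum_powerset_univ_add_sum_delta (f : (V → ZMod 2) → ℂ) (x : V → ZMod 2) :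
    ∑ T ∈ (univ : Finset V).powerset, f (x + ∑ i ∈ T, delta i) = ∑ y, f y := by
  have two : ∀ a b : ZMod 2, a + (if b = a then 0 else 1) = b := by decide
  refine Finset.sum_nbij' (fun T => x + ∑ i ∈ T, delta i)
    (fun y => univ.filter fun v => y v ≠ x v) (by simp) (by simp) ?_ ?_ (by simp)
  · intro T _
    ext v
    rw [Finset.mem_filter_univ, Pi.add_apply, sum_delta_apply]
    simp
  · intro y _
    ext v
    rw [Pi.add_apply, sum_delta_apply]
    simpa using two (x v) (y v)

/-- The product of the stabilizer projectors `(S_i + I)/2` over all vertices is the rank-one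
orthogonal projection onto the graph state: for every `ψ`,
`(∏_{i ∈ V} (S_i + I)/2) ψ = ⟨g, ψ⟩ • g`. -/
theorem stabProj_univ_eq_graphState_proj (G : SimpleGraph V) (ψ : (V → ZMod 2) → ℂ) :
    stabProj G univ *ᵥ ψ = (star (graphState G) ⬝ᵥ ψ) • graphState G := by
  set c : ℂ := ((Real.sqrt 2 ^ Fintype.card V : ℝ) : ℂ) with hc
  have hg : ∀ y, graphState G y = c⁻¹ * graphSign G y := fun y => by
    rw [graphState, graphSign, div_eq_inv_mul]
  have hstar : star c⁻¹ = c⁻¹ := by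
    rw [hc, star_inv₀]
    exact congrArg _ (Complex.conj_ofReal _)
  have hcc : c⁻¹ * c⁻¹ = (2 : ℂ)⁻¹ ^ Fintype.card V := by
    rw [← mul_inv, hc, ← Complex.ofReal_mul, ← mul_pow, Real.mul_self_sqrt (by norm_num)]
    simp
  have hinner : star (graphState G) ⬝ᵥ ψ = c⁻¹ * ∑ y, graphSign G y * ψ y := by
    simp only [dotProduct, Pi.star_apply, hg, star_mul', hstar, star_graphSign, Finset.mul_sum,
      mul_assoc]
  ext x
  rw [stabProj, list_prod_stab_mulVec_apply G ψ (Finset.nodup_toList _), Finset.toList_toFinset,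
    sum_powerset_univ_add_sum_delta (fun y => graphSign G y * ψ y), Finset.length_toList,
    Finset.card_univ, Pi.smul_apply, smul_eq_mul, hinner, hg, ← hcc]
  ring
end
end

section
/- For every subset A ⊆ V, the reduced density matrix ρ_A of the graph state g satisfies Tr(ρ_A) = 1 and ρ_A · ρ_A = 2^{−r(A)} · ρ_A; in other words, ρ_A has flat spectrum, its nonzero eigenvalues all being equal to 2^{−r(A)}. -/
open Matrix Finset
open scoped Classical ComplexOrder

noncomputable section

variable {V : Type} [Fintype V] [DecidableEq V]

/-- Edges of a glued configuration lie inside `A`, inside the complement, or cross. -/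
lemma edgeCount_glue (G : SimpleGraph V) (A : Finset V) (a : {v // v ∈ A} → ZMod 2)
    (b : {v // v ∉ A} → ZMod 2) :
    edgeCount G (glue A a b) = edgeCount G (glue A a 0) + edgeCount G (glue A 0 b) +
      #{p : {v // v ∈ A} × {v // v ∉ A} | G.Adj p.1 p.2 ∧ a p.1 = 1 ∧ b p.2 = 1} := by
  set S : Finset ({v // v ∈ A} × {v // v ∉ A}) := {p | G.Adj p.1 p.2 ∧ a p.1 = 1 ∧ b p.2 = 1}
  have hinj : Function.Injective
      (fun p : {v // v ∈ A} × {v // v ∉ A} => s(p.1.1, p.2.1)) := by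
    rintro ⟨⟨i, hi⟩, ⟨j, hj⟩⟩ ⟨⟨k, hk⟩, ⟨l, hl⟩⟩ h
    simp only [Sym2.eq_iff] at h
    grind
  rw [← Finset.card_image_of_injective S hinj]
  have hmem : ∀ (x : V → ZMod 2) (i j : V),
      s(i, j) ∈ G.edgeFinset.filter (fun e => ∀ v ∈ e, x v = 1) ↔
        G.Adj i j ∧ x i = 1 ∧ x j = 1 := by
    simp [Finset.mem_filter]
  unfold edgeCount
  rw [← Finset.card_union_of_disjoint, ← Finset.card_union_of_disjoint]
  · congr 1
    ext e
    induction e using Sym2.ind with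
    | _ i j =>
      have hs := G.adj_comm i j
      by_cases hi : i ∈ A <;> by_cases hj : j ∈ A <;>
        simp only [Finset.mem_union, hmem] <;> simp [S, glue, hi, hj] <;> grind
  · rw [Finset.disjoint_left]
    intro e
    induction e using Sym2.ind with
    | _ i j =>
      by_cases hi : i ∈ A <;> by_cases hj : j ∈ A <;>
        simp only [Finset.mem_union, hmem] <;> simp [S, glue, hi, hj] <;> grind
  · rw [Finset.disjoint_left]
    intro e
    induction e using Sym2.ind with
    | _ i j =>
      by_cases hi : i ∈ A <;> by_cases hj : j ∈ A <;>
        simp only [hmem] <;> simp [glue, hi, hj]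

lemma natCast_card_crossing (G : SimpleGraph V) (A : Finset V) (a : {v // v ∈ A} → ZMod 2)
    (b : {v // v ∉ A} → ZMod 2) :
    ((#{p : {v // v ∈ A} × {v // v ∉ A} | G.Adj p.1 p.2 ∧ a p.1 = 1 ∧ b p.2 = 1} : ℕ) : ZMod 2) =
      a ᵥ* gammaMat G A ⬝ᵥ b := by
  rw [Finset.card_filter, Fintype.sum_prod_type, Finset.sum_comm]
  simp only [dotProduct, vecMul, gammaMat, of_apply, Finset.sum_mul]
  push_cast
  refine Finset.sum_congr rfl fun j _ => Finset.sum_congr rfl fun i _ => ?_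
  have key : ∀ s t : ZMod 2, (if s = 1 ∧ t = 1 then (1 : ZMod 2) else 0) = s * t := by decide
  by_cases h : G.Adj i.1 j.1 <;> simp [h, key]

/-- The nontrivial additive character `z ↦ (-1)^z` of `ZMod 2`. -/
def signChar : AddChar (ZMod 2) ℂ := AddChar.zmodChar 2 (ζ := -1) (by norm_num)

lemma neg_one_pow_eq_signChar (n : ℕ) : (-1 : ℂ) ^ n = signChar n :=
  (AddChar.zmodChar_apply' _ n).symm

lemma signChar_one : signChar 1 = -1 := by
  simpa using (neg_one_pow_eq_signChar 1).symm

lemma sum_signChar_dotProduct {ι : Type*} [Fintype ι] [DecidableEq ι] (c : ι → ZMod 2) :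
    ∑ b : ι → ZMod 2, signChar (c ⬝ᵥ b) = if c = 0 then (2 : ℂ) ^ Fintype.card ι else 0 := by
  let ψ : AddChar (ι → ZMod 2) ℂ :=
    signChar.compAddMonoidHom (dotProductBilin (ZMod 2) (ZMod 2) c).toAddMonoidHom
  have hψ : ψ = 0 ↔ c = 0 := by
    constructor
    · intro h
      ext i
      have h1 : signChar (c i) = 1 := by
        have := DFunLike.congr_fun h (Pi.single i 1)
        simpa [ψ] using this
      generalize c i = z at h1
      fin_cases z
      · rfl
      · exfalso
        have h2 : signChar 1 = 1 := h1
        norm_num [signChar_one] at h2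
    · rintro rfl
      ext b
      simp [ψ]
  have := AddChar.sum_eq_ite ψ
  simpa [ψ, hψ] using this

lemma card_vecMul_eq_zero {K m n : Type*} [Field K] [Fintype K] [Fintype m]
    [DecidableEq m] [Fintype n] (M : Matrix m n K) :
    #{a : m → K | a ᵥ* M = 0} * Fintype.card K ^ M.rank = Fintype.card K ^ Fintype.card m := by
  have h := M.vecMulLinear.finrank_range_add_finrank_ker
  have hr : Module.finrank K (LinearMap.range M.vecMulLinear) = M.rank := by
    rw [← rank_transpose, Matrix.rank, ← vecMulLinear_transpose, transpose_transpose]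
  rw [hr, Module.finrank_pi] at h
  have hc := Module.card_eq_pow_finrank (K := K) (V := LinearMap.ker M.vecMulLinear)
  have hk : #{a : m → K | a ᵥ* M = 0} = Fintype.card (LinearMap.ker M.vecMulLinear) := by
    rw [← Fintype.card_subtype]
    exact Fintype.card_congr (Equiv.subtypeEquivRight fun a => by simp)
  rw [hk, hc, ← pow_add, add_comm, h]

/-- The phase contributed by the edges inside `A`. -/
def innerPhase (G : SimpleGraph V) (A : Finset V) (a : {v // v ∈ A} → ZMod 2) : ℂ :=
  (-1) ^ edgeCount G (glue A a 0)

lemma innerPhase_mul_self (G : SimpleGraph V) (A : Finset V) (a : {v // v ∈ A} → ZMod 2) :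
    innerPhase G A a * innerPhase G A a = 1 := by
  rw [innerPhase, ← pow_add, Even.neg_one_pow ⟨_, rfl⟩]

lemma graphState_glue_mul_conj (G : SimpleGraph V) (A : Finset V)
    (a a' : {v // v ∈ A} → ZMod 2) (b : {v // v ∉ A} → ZMod 2) :
    graphState G (glue A a b) * (starRingEnd ℂ) (graphState G (glue A a' b)) =
      ((2 : ℂ) ^ Fintype.card V)⁻¹ * (innerPhase G A a * innerPhase G A a') *
        signChar ((a - a') ᵥ* gammaMat G A ⬝ᵥ b) := by
  have hs : (((√2 : ℝ) : ℂ) ^ Fintype.card V) * ((√2 : ℝ) : ℂ) ^ Fintype.card V =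
      2 ^ Fintype.card V := by
    rw [← mul_pow, ← Complex.ofReal_mul, Real.mul_self_sqrt zero_le_two]
    norm_num
  have hb : ((-1 : ℂ) ^ edgeCount G (glue A 0 b)) * (-1) ^ edgeCount G (glue A 0 b) = 1 := by
    rw [← pow_add, Even.neg_one_pow ⟨_, rfl⟩]
  have hsub : (a - a') ᵥ* gammaMat G A ⬝ᵥ b =
      a ᵥ* gammaMat G A ⬝ᵥ b + a' ᵥ* gammaMat G A ⬝ᵥ b := by
    rw [sub_vecMul, sub_dotProduct, CharTwo.sub_eq_add]
  rw [hsub, AddChar.map_add_eq_mul, ← natCast_card_crossing, ← natCast_card_crossing,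
    ← neg_one_pow_eq_signChar, ← neg_one_pow_eq_signChar]
  simp only [graphState, innerPhase, edgeCount_glue G A a b, edgeCount_glue G A a' b, pow_add,
    map_div₀, map_mul, map_pow, map_neg, map_one, Complex.conj_ofReal, Complex.ofReal_pow]
  rw [div_mul_div_comm, hs, div_eq_inv_mul]
  linear_combination ((2 : ℂ) ^ Fintype.card V)⁻¹ * (-1) ^ edgeCount G (glue A a 0) *
    (-1) ^ edgeCount G (glue A a' 0) *
    (-1) ^ #{p : {v // v ∈ A} × {v // v ∉ A} | G.Adj p.1 p.2 ∧ a p.1 = 1 ∧ b p.2 = 1} *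
    (-1) ^ #{p : {v // v ∈ A} × {v // v ∉ A} | G.Adj p.1 p.2 ∧ a' p.1 = 1 ∧ b p.2 = 1} * hb

lemma rdm_graphState_apply (G : SimpleGraph V) (A : Finset V)
    (a a' : {v // v ∈ A} → ZMod 2) :
    rdm A (graphState G) a a' =
      ((2 : ℂ) ^ #A)⁻¹ * (innerPhase G A a * innerPhase G A a') *
        if (a - a') ᵥ* gammaMat G A = 0 then 1 else 0 := by
  have hcard : Fintype.card V = #A + Fintype.card {v // v ∉ A} := by
    have h := Fintype.card_subtype_compl (fun v => v ∈ A)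
    have h' := A.card_le_univ
    rw [Fintype.card_coe] at h
    lia
  simp only [rdm, of_apply, graphState_glue_mul_conj, ← Finset.mul_sum, sum_signChar_dotProduct]
  split_ifs
  · rw [hcard, pow_add]
    field_simp
  · simp

/-- For every `A ⊆ V`, the reduced density matrix `ρ_A` of the graph state has trace 1 and
satisfies `ρ_A * ρ_A = 2^{-r(A)} • ρ_A`: its spectrum is flat, all nonzero eigenvalues
being `2^{-r(A)}`. -/
theorem rdm_graphState_flat (G : SimpleGraph V) (A : Finset V) :
    (rdm A (graphState G)).trace = 1 ∧
      rdm A (graphState G) * rdm A (graphState G)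
        = ((2 : ℂ) ^ gRank G A)⁻¹ • rdm A (graphState G) := by
  refine ⟨?_, ?_⟩
  · simp [Matrix.trace, rdm_graphState_apply, innerPhase_mul_self]
  · ext a c
    have hK : (#{d : {v // v ∈ A} → ZMod 2 | d ᵥ* gammaMat G A = 0} : ℂ) * 2 ^ gRank G A =
        2 ^ #A := by
      have := card_vecMul_eq_zero (gammaMat G A)
      rw [ZMod.card, Fintype.card_coe] at this
      exact_mod_cast this
    have hsum : ∑ b : {v // v ∈ A} → ZMod 2,
        (if (a - b) ᵥ* gammaMat G A = 0 then (1 : ℂ) else 0) *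
          (if (b - c) ᵥ* gammaMat G A = 0 then 1 else 0) =
        (if (a - c) ᵥ* gammaMat G A = 0 then 1 else 0) *
          #{d : {v // v ∈ A} → ZMod 2 | d ᵥ* gammaMat G A = 0} := by
      rw [← Equiv.sum_comp (Equiv.subRight c).symm, Finset.card_filter]
      push_cast
      rw [Finset.mul_sum]
      refine Finset.sum_congr rfl fun d _ => ?_
      by_cases hd : d ᵥ* gammaMat G A = 0 <;> simp [hd, sub_vecMul, add_vecMul]
    have hterm : ∀ b, rdm A (graphState G) a b * rdm A (graphState G) b c =
        ((2 : ℂ) ^ #A)⁻¹ * ((2 : ℂ) ^ #A)⁻¹ * (innerPhase G A a * innerPhase G A c) *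
          ((if (a - b) ᵥ* gammaMat G A = 0 then (1 : ℂ) else 0) *
            (if (b - c) ᵥ* gammaMat G A = 0 then 1 else 0)) := by
      intro b
      rw [rdm_graphState_apply, rdm_graphState_apply]
      linear_combination ((2 : ℂ) ^ #A)⁻¹ * ((2 : ℂ) ^ #A)⁻¹ *
        (innerPhase G A a * innerPhase G A c) *
          ((if (a - b) ᵥ* gammaMat G A = 0 then (1 : ℂ) else 0) *
            (if (b - c) ᵥ* gammaMat G A = 0 then 1 else 0)) * innerPhase_mul_self G A b
    rw [mul_apply, Finset.sum_congr rfl fun b _ => hterm b, ← Finset.mul_sum, hsum,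
      Matrix.smul_apply, rdm_graphState_apply, smul_eq_mul, ← hK]
    have hne : (#{d : {v // v ∈ A} → ZMod 2 | d ᵥ* gammaMat G A = 0} : ℂ) ≠ 0 := by
      intro h
      rw [h, zero_mul] at hK
      exact pow_ne_zero _ two_ne_zero hK.symm
    field_simp
end
end

section
/- (Proposition 1, fully separable case.) Let 𝒫 = {A_1, …, A_m} be a partition of V into m ≥ 2 nonempty parts and g the graph state of G. Then every 𝒫-fully separable density matrix ρ satisfies ⟨g, ρ g⟩ ≤ min_A 2^{−r(A)}, where the minimum is over all nonempty proper unions of parts A of 𝒫. -/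
open Matrix Finset
open scoped Classical ComplexOrder

noncomputable section

variable {V : Type} [Fintype V] [DecidableEq V]

lemma ZMod.eq_zero_or_eq_one (z : ZMod 2) : z = 0 ∨ z = 1 := by
  revert z
  decide

/-- The sign character `z ↦ (-1)^z` of `ZMod 2`. -/
def sgn (z : ZMod 2) : ℂ := (-1) ^ z.val

lemma sgn_natCast (n : ℕ) : sgn (n : ZMod 2) = (-1) ^ n := by
  rw [sgn, ZMod.val_natCast, ← neg_one_pow_eq_pow_mod_two]

lemma sgn_add (y z : ZMod 2) : sgn (y + z) = sgn y * sgn z := by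
  rw [← ZMod.natCast_zmod_val y, ← ZMod.natCast_zmod_val z, ← Nat.cast_add]
  simp only [sgn_natCast, pow_add]

lemma sgn_sum {ι : Type*} (s : Finset ι) (f : ι → ZMod 2) :
    sgn (∑ i ∈ s, f i) = ∏ i ∈ s, sgn (f i) := by
  induction s using Finset.induction_on with
  | empty => simp [sgn]
  | insert i s hi ih => rw [Finset.sum_insert hi, Finset.prod_insert hi, sgn_add, ih]

lemma star_sgn (z : ZMod 2) : star (sgn z) = sgn z := by simp [sgn]

lemma sum_sgn_mul (z : ZMod 2) : ∑ y : ZMod 2, sgn (y * z) = if z = 0 then 2 else 0 := by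
  have h : ∀ f : ZMod 2 → ℂ, ∑ y, f y = f 0 + f 1 := fun f => Fin.sum_univ_two f
  rw [h]
  have h1 : sgn 1 = -1 := by simpa using sgn_natCast 1
  have h0 : sgn 0 = 1 := by simpa using sgn_natCast 0
  rcases ZMod.eq_zero_or_eq_one z with rfl | rfl
  · simp [h0]; norm_num
  · simp [h0, h1]

/-- Orthogonality of the characters of `(ZMod 2)^ι`. -/
lemma sum_sgn_dotProduct {ι : Type*} [Fintype ι] [DecidableEq ι] (c : ι → ZMod 2) :
    ∑ a : ι → ZMod 2, sgn (a ⬝ᵥ c) = if c = 0 then 2 ^ Fintype.card ι else 0 := by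
  simp only [dotProduct, sgn_sum]
  have h := Finset.prod_univ_sum (fun _ : ι => (univ : Finset (ZMod 2)))
    (fun i y => sgn (y * c i))
  rw [Fintype.piFinset_univ] at h
  rw [← h]
  simp only [sum_sgn_mul]
  split_ifs with hc
  · simp [hc]
  · obtain ⟨i, hi⟩ := Function.ne_iff.1 hc
    exact Finset.prod_eq_zero (mem_univ i) (if_neg hi)

lemma card_ker_mulVec {ι κ : Type*} [Fintype ι] [Fintype κ] [DecidableEq κ]
    (M : Matrix ι κ (ZMod 2)) :
    #{d : κ → ZMod 2 | M *ᵥ d = 0} * 2 ^ M.rank = 2 ^ Fintype.card κ := by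
  have h1 := LinearMap.finrank_range_add_finrank_ker M.mulVecLin
  have h2 := Module.card_eq_pow_finrank (K := ZMod 2) (V := LinearMap.ker M.mulVecLin)
  rw [Module.finrank_fintype_fun_eq_card] at h1
  rw [ZMod.card] at h2
  have h3 : #{d : κ → ZMod 2 | M *ᵥ d = 0} = Fintype.card (LinearMap.ker M.mulVecLin) := by
    rw [← Fintype.card_subtype]
    exact Fintype.card_congr (Equiv.subtypeEquivRight fun d => by simp)
  rw [h3, h2, ← h1, ← pow_add, Matrix.rank, add_comm]

/-- The sign matrix `(-1)^{aᵀ M b}` has squared operator norm at most `2^{|ι| + |κ| - rank M}`. -/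
lemma sum_norm_sq_sgn_le {ι κ : Type*} [Fintype ι] [Fintype κ] [DecidableEq ι] [DecidableEq κ]
    (M : Matrix ι κ (ZMod 2)) (χ : (κ → ZMod 2) → ℂ) :
    ∑ a : ι → ZMod 2, ‖∑ b, sgn (a ⬝ᵥ M *ᵥ b) * χ b‖ ^ 2 ≤
      2 ^ Fintype.card ι * (2 ^ Fintype.card κ * (2 ^ M.rank)⁻¹) * ∑ b, ‖χ b‖ ^ 2 := by
  have hsub : ∀ b b' : κ → ZMod 2, ∀ a : ι → ZMod 2,
      sgn (a ⬝ᵥ M *ᵥ b) * sgn (a ⬝ᵥ M *ᵥ b') = sgn (a ⬝ᵥ M *ᵥ (b + b')) := by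
    intro b b' a
    rw [mulVec_add, dotProduct_add, sgn_add]
  have key : ((∑ a : ι → ZMod 2, ‖∑ b, sgn (a ⬝ᵥ M *ᵥ b) * χ b‖ ^ 2 : ℝ) : ℂ) =
      2 ^ Fintype.card ι * ∑ b, ∑ b', if M *ᵥ (b + b') = 0 then χ b * star (χ b') else 0 := by
    push_cast
    calc ∑ a : ι → ZMod 2, ((‖∑ b, sgn (a ⬝ᵥ M *ᵥ b) * χ b‖ : ℂ)) ^ 2
        = ∑ a : ι → ZMod 2, ∑ b, ∑ b', sgn (a ⬝ᵥ M *ᵥ (b + b')) * (χ b * star (χ b')) := by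
          refine Finset.sum_congr rfl fun a _ => ?_
          rw [← Complex.mul_conj', map_sum, Finset.sum_mul_sum]
          refine Finset.sum_congr rfl fun b _ => Finset.sum_congr rfl fun b' _ => ?_
          rw [← hsub, map_mul, starRingEnd_apply, starRingEnd_apply, star_sgn]
          ring
      _ = _ := by
          rw [Finset.sum_comm, Finset.mul_sum]
          refine Finset.sum_congr rfl fun b _ => ?_
          rw [Finset.sum_comm, Finset.mul_sum]
          refine Finset.sum_congr rfl fun b' _ => ?_
          rw [← Finset.sum_mul, sum_sgn_dotProduct]
          split_ifs <;> simp
  have hker : ∀ b : κ → ZMod 2, (∑ b', if M *ᵥ (b + b') = 0 then (1 : ℝ) else 0) =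
      2 ^ Fintype.card κ * (2 ^ M.rank)⁻¹ := by
    intro b
    rw [Fintype.sum_equiv (Equiv.addLeft b) (fun b' => if M *ᵥ (b + b') = 0 then (1 : ℝ) else 0)
      (fun d => if M *ᵥ d = 0 then (1 : ℝ) else 0) (fun _ => rfl), Finset.sum_boole,
      eq_mul_inv_iff_mul_eq₀ (by positivity)]
    exact_mod_cast card_ker_mulVec M
  set K : ℝ := 2 ^ Fintype.card κ * (2 ^ M.rank)⁻¹
  have schur : ‖∑ b, ∑ b', if M *ᵥ (b + b') = 0 then χ b * star (χ b') else 0‖ ≤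
      K * ∑ b, ‖χ b‖ ^ 2 := by
    calc _ ≤ ∑ b, ∑ b', ((if M *ᵥ (b + b') = 0 then (1 : ℝ) else 0) * (‖χ b‖ ^ 2 / 2) +
            (if M *ᵥ (b' + b) = 0 then (1 : ℝ) else 0) * (‖χ b'‖ ^ 2 / 2)) := by
          refine (norm_sum_le _ _).trans (Finset.sum_le_sum fun b _ =>
            (norm_sum_le _ _).trans (Finset.sum_le_sum fun b' _ => ?_))
          rw [add_comm b' b]
          split_ifs
          · rw [norm_mul, norm_star]
            nlinarith [sq_nonneg (‖χ b‖ - ‖χ b'‖)]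
          · simp
      _ = K * ∑ b, ‖χ b‖ ^ 2 := by
          simp only [Finset.sum_add_distrib]
          rw [Finset.sum_comm (f := fun b b' =>
            (if M *ᵥ (b' + b) = 0 then (1 : ℝ) else 0) * (‖χ b'‖ ^ 2 / 2))]
          simp only [← Finset.sum_mul, hker, ← Finset.mul_sum, ← Finset.sum_div]
          ring
  have := congrArg norm key
  rw [Complex.norm_real, Real.norm_of_nonneg (by positivity), norm_mul, norm_pow,
    Complex.norm_ofNat] at this
  rw [this, mul_assoc]
  gcongr

/-- Cauchy–Schwarz combined with the operator-norm bound for the sign matrix. -/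
lemma norm_sq_sum_sgn_le {ι κ : Type*} [Fintype ι] [Fintype κ] [DecidableEq ι] [DecidableEq κ]
    (M : Matrix ι κ (ZMod 2)) (φ : (ι → ZMod 2) → ℂ) (χ : (κ → ZMod 2) → ℂ) :
    ‖∑ a, ∑ b, sgn (a ⬝ᵥ M *ᵥ b) * φ a * χ b‖ ^ 2 ≤
      2 ^ Fintype.card ι * (2 ^ Fintype.card κ * (2 ^ M.rank)⁻¹) *
        ((∑ a, ‖φ a‖ ^ 2) * ∑ b, ‖χ b‖ ^ 2) := by
  calc ‖∑ a, ∑ b, sgn (a ⬝ᵥ M *ᵥ b) * φ a * χ b‖ ^ 2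
      ≤ (∑ a, ‖φ a‖ * ‖∑ b, sgn (a ⬝ᵥ M *ᵥ b) * χ b‖) ^ 2 := by
        gcongr
        refine (norm_sum_le _ _).trans_eq (Finset.sum_congr rfl fun a _ => ?_)
        rw [← norm_mul, Finset.mul_sum]
        exact congrArg norm (Finset.sum_congr rfl fun b _ => by ring)
    _ ≤ (∑ a, ‖φ a‖ ^ 2) * ∑ a : ι → ZMod 2, ‖∑ b, sgn (a ⬝ᵥ M *ᵥ b) * χ b‖ ^ 2 :=
        Finset.sum_mul_sq_le_sq_mul_sq _ _ _
    _ ≤ (∑ a, ‖φ a‖ ^ 2) * (2 ^ Fintype.card ι * (2 ^ Fintype.card κ * (2 ^ M.rank)⁻¹) *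
          ∑ b, ‖χ b‖ ^ 2) := by
        gcongr
        exact sum_norm_sq_sgn_le M χ
    _ = _ := by ring

lemma sum_glue {R : Type*} [AddCommMonoid R] (A : Finset V) (f : (V → ZMod 2) → R) :
    ∑ x, f x = ∑ a, ∑ b, f (glue A a b) := by
  rw [← Fintype.sum_prod_type']
  refine Fintype.sum_equiv (Equiv.piEquivPiSubtypeProd (· ∈ A) (fun _ => ZMod 2)) _ _ fun x => ?_
  congr 1
  ext v
  simp [glue, Equiv.piEquivPiSubtypeProd]

lemma restrictTo_glue {W : Type} [DecidableEq W] (A : Finset W)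
    (a : {v // v ∈ A} → ZMod 2) (b : {v // v ∉ A} → ZMod 2) :
    restrictTo A (glue A a b) = a := by
  ext v
  simp [restrictTo, glue]

lemma restrictOut_glue {W : Type} [DecidableEq W] (A : Finset W)
    (a : {v // v ∈ A} → ZMod 2) (b : {v // v ∉ A} → ZMod 2) :
    restrictOut A (glue A a b) = b := by
  ext v
  simp [restrictOut, glue, v.2]

lemma glue_of_mem {W : Type} [DecidableEq W] {A : Finset W} {v : W} (h : v ∈ A)
    (a : {v // v ∈ A} → ZMod 2) (b : {v // v ∉ A} → ZMod 2) :
    glue A a b v = a ⟨v, h⟩ := dif_pos h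

lemma glue_of_notMem {W : Type} [DecidableEq W] {A : Finset W} {v : W} (h : v ∉ A)
    (a : {v // v ∈ A} → ZMod 2) (b : {v // v ∉ A} → ZMod 2) :
    glue A a b v = b ⟨v, h⟩ := dif_neg h

lemma sgn_dotProduct_gammaMat (G : SimpleGraph V) (A : Finset V)
    (a : {v // v ∈ A} → ZMod 2) (b : {v // v ∉ A} → ZMod 2) :
    sgn (a ⬝ᵥ gammaMat G A *ᵥ b) =
      (-1) ^ #{p : {v // v ∈ A} × {v // v ∉ A} | G.Adj p.1 p.2 ∧ a p.1 = 1 ∧ b p.2 = 1} := by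
  rw [← sgn_natCast, Finset.card_filter, Fintype.sum_prod_type]
  push_cast
  simp only [dotProduct, mulVec, Finset.mul_sum, gammaMat, of_apply]
  congr 1
  refine Finset.sum_congr rfl fun i _ => Finset.sum_congr rfl fun j _ => ?_
  rcases ZMod.eq_zero_or_eq_one (a i) with hi | hi <;>
    rcases ZMod.eq_zero_or_eq_one (b j) with hj | hj <;> simp [hi, hj]

lemma graphState_glue (G : SimpleGraph V) (A : Finset V) (a : {v // v ∈ A} → ZMod 2)
    (b : {v // v ∉ A} → ZMod 2) :
    graphState G (glue A a b) = (-1) ^ edgeCount G (glue A a 0) *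
      (-1) ^ edgeCount G (glue A 0 b) * sgn (a ⬝ᵥ gammaMat G A *ᵥ b) /
        ((Real.sqrt 2 ^ Fintype.card V : ℝ) : ℂ) := by
  rw [graphState, edgeCount_glue, pow_add, pow_add, sgn_dotProduct_gammaMat]

lemma dotProduct_star_self {ι : Type*} [Fintype ι] (ψ : ι → ℂ) :
    star ψ ⬝ᵥ ψ = ((∑ x, ‖ψ x‖ ^ 2 : ℝ) : ℂ) := by
  push_cast
  exact Finset.sum_congr rfl fun x _ => Complex.conj_mul' (ψ x)

/-- A unit product vector across `{A, V \ A}` has fidelity at most `2^{-r(A)}` with the graph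
state. -/
lemma norm_sq_dotProduct_graphState_le (G : SimpleGraph V) {A : Finset V}
    {ψ : (V → ZMod 2) → ℂ} (hunit : IsUnit' ψ) (hprod : IsProdVec A ψ) :
    ‖star ψ ⬝ᵥ graphState G‖ ^ 2 ≤ (2 ^ gRank G A)⁻¹ := by
  obtain ⟨φ, χ, h⟩ := hprod
  have hψ : ∀ a b, ψ (glue A a b) = φ a * χ b := fun a b => by
    rw [h, restrictTo_glue, restrictOut_glue]
  have hnorm : (∑ a, ‖φ a‖ ^ 2) * ∑ b, ‖χ b‖ ^ 2 = 1 := by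
    rw [IsUnit', dotProduct_star_self, sum_glue A] at hunit
    simp only [hψ, norm_mul, mul_pow, ← Finset.mul_sum, ← Finset.sum_mul] at hunit
    exact_mod_cast hunit
  have hover : star ψ ⬝ᵥ graphState G = (∑ a, ∑ b, sgn (a ⬝ᵥ gammaMat G A *ᵥ b) *
      ((-1) ^ edgeCount G (glue A a 0) * star (φ a)) *
      ((-1) ^ edgeCount G (glue A 0 b) * star (χ b))) /
        ((Real.sqrt 2 ^ Fintype.card V : ℝ) : ℂ) := by
    rw [dotProduct, sum_glue A, Finset.sum_div]
    refine Finset.sum_congr rfl fun a _ => ?_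
    rw [Finset.sum_div]
    refine Finset.sum_congr rfl fun b _ => ?_
    rw [Pi.star_apply, hψ, graphState_glue, star_mul']
    ring
  have hcard : Fintype.card V = Fintype.card {v // v ∈ A} + Fintype.card {v // v ∉ A} := by
    rw [← Fintype.card_sum]
    exact Fintype.card_congr (Equiv.sumCompl (· ∈ A)).symm
  have hmain := norm_sq_sum_sgn_le (gammaMat G A)
    (fun a => (-1) ^ edgeCount G (glue A a 0) * star (φ a))
    (fun b => (-1) ^ edgeCount G (glue A 0 b) * star (χ b))
  simp only [norm_mul, norm_pow, norm_neg, norm_one, one_pow, one_mul, norm_star, hnorm,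
    mul_one] at hmain
  rw [hover, norm_div, div_pow, Complex.norm_real, Real.norm_of_nonneg (by positivity),
    ← pow_mul, mul_comm (Fintype.card V) 2, pow_mul, Real.sq_sqrt zero_le_two,
    div_le_iff₀ (by positivity), hcard, pow_add]
  refine hmain.trans_eq ?_
  rw [gRank]
  ring

/-- A fully separable pure state is a product vector across every union of parts. -/
lemma FullSepPure.isProdVec {m : ℕ} {P : Fin m → Finset V} (hP : IsPartition P)
    {ψ : (V → ZMod 2) → ℂ} (h : FullSepPure P ψ) (S : Finset (Fin m)) :
    IsProdVec (S.biUnion P) ψ := by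
  obtain ⟨φ, hφ⟩ := h
  refine ⟨fun a => ∏ t ∈ S, φ t (restrictTo (P t) (glue _ a 0)),
    fun b => ∏ t ∈ Sᶜ, φ t (restrictTo (P t) (glue _ 0 b)), fun x => ?_⟩
  rw [hφ, ← Finset.prod_mul_prod_compl S]
  congr 1
  · refine Finset.prod_congr rfl fun t ht => congrArg (φ t) (funext fun v => ?_)
    exact (glue_of_mem (Finset.mem_biUnion.2 ⟨t, ht, v.2⟩) (restrictTo (S.biUnion P) x) 0).symm
  · refine Finset.prod_congr rfl fun t ht => congrArg (φ t) (funext fun v => ?_)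
    refine (glue_of_notMem (v := v.1) (fun hv => ?_) 0 (restrictOut (S.biUnion P) x)).symm
    obtain ⟨t', ht', hv'⟩ := Finset.mem_biUnion.1 hv
    refine Finset.disjoint_left.1 (hP.2.1 t t' ?_) v.2 hv'
    rintro rfl
    exact Finset.mem_compl.1 ht ht'

lemma dotProduct_mixture_mulVec {ι : Type*} [Fintype ι] {M : ℕ} (p : Fin M → ℝ)
    (ψ : Fin M → ι → ℂ) (g : ι → ℂ) :
    star g ⬝ᵥ ((∑ i, (p i : ℂ) • vecMulVec (ψ i) (star (ψ i))) *ᵥ g) =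
      ((∑ i, p i * ‖star (ψ i) ⬝ᵥ g‖ ^ 2 : ℝ) : ℂ) := by
  rw [sum_mulVec, dotProduct_sum]
  push_cast
  refine Finset.sum_congr rfl fun i _ => ?_
  have hconj : star g ⬝ᵥ ψ i = star (star (ψ i) ⬝ᵥ g) := by
    rw [star_dotProduct]
  rw [smul_mulVec, vecMulVec_mulVec, dotProduct_smul, op_smul_eq_smul, dotProduct_smul, hconj,
    smul_eq_mul, smul_eq_mul, ← Complex.mul_conj']
  rfl

/-- Proposition 1, fully separable case: for a partition `P` of `V` into `m ≥ 2` nonempty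
parts, every `P`-fully separable density matrix `ρ` satisfies
`⟨g, ρ g⟩ ≤ min_A 2^{-r(A)}`, the minimum over nonempty proper unions of parts `A`. -/
theorem fullSep_fidelity_le (G : SimpleGraph V) {m : ℕ} (hm : 2 ≤ m)
    (P : Fin m → Finset V) (hP : IsPartition P)
    (ρ : Matrix (V → ZMod 2) (V → ZMod 2) ℂ) (hρd : IsDensity ρ) (hρ : FullSep P ρ) :
    star (graphState G) ⬝ᵥ (ρ *ᵥ graphState G) ≤
      ((⨅ S : {S : Finset (Fin m) // S.Nonempty ∧ S ≠ univ},
        ((2 : ℝ) ^ gRank G (S.1.biUnion P))⁻¹ : ℝ) : ℂ) := by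
  obtain ⟨M, p, ψ, hp, hp1, hunit, hsep, rfl⟩ := hρ
  rw [dotProduct_mixture_mulVec, Complex.real_le_real]
  have : Nonempty {S : Finset (Fin m) // S.Nonempty ∧ S ≠ univ} := by
    refine ⟨{⟨0, by omega⟩}, Finset.singleton_nonempty _, fun h => ?_⟩
    have := congrArg Finset.card h
    rw [Finset.card_singleton, Finset.card_univ, Fintype.card_fin] at this
    omega
  refine le_ciInf fun S => ?_
  calc ∑ i, p i * ‖star (ψ i) ⬝ᵥ graphState G‖ ^ 2
      ≤ ∑ i, p i * (2 ^ gRank G (S.1.biUnion P))⁻¹ :=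
        Finset.sum_le_sum fun i _ => mul_le_mul_of_nonneg_left
          (norm_sq_dotProduct_graphState_le G (hunit i) ((hsep i).isProdVec hP S.1)) (hp i)
    _ = (2 ^ gRank G (S.1.biUnion P))⁻¹ := by rw [← Finset.sum_mul, hp1, one_mul]
end
end
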